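/- Corollary (first sufficient condition for ℓ = 2). Suppose ℓ = 2, a 1 1 = a 1 0, and a n 1 = a n 0 + a n 2 for all n ≥ 2. Then the weighted lattice-path matrix M is totally positive, and if moreover t ≥ 1 then for every n ∈ ℕ the Toeplitz matrix 𝒯(c) of the n-th row sequence c k = M n k is totally positive. -/

import Mathlib

open Finset

/-- A multivariate polynomial with real coefficients is *nonnegative* if all of
its coefficients are nonnegative. -/
def PolyNonneg {σ : Type*} (p : MvPolynomial σ ℝ) : Prop :=
  ∀ m, 0 ≤ p.coeff m

/-- An `ℕ × ℕ` matrix with entries in `MvPolynomial σ ℝ` is *totally positive*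
if every minor (taken along strictly increasing row and column indices) is a
nonnegative polynomial. -/
def TP {σ : Type*} (A : ℕ → ℕ → MvPolynomial σ ℝ) : Prop :=
  ∀ r : ℕ, 1 ≤ r → ∀ ρ κ : Fin r → ℕ, StrictMono ρ → StrictMono κ →
    PolyNonneg (Matrix.of fun i j : Fin r => A (ρ i) (κ j)).det

/-- The weighted lattice-path matrix `M`:
`M n 0 = ∏_{i=1}^n b i`, `M n k = 0` for `k ≥ 1` and `n < t`, and
`M n k = Σ_{i=0}^{ℓ} (a n i) * M (n-t-i) (k-1) + (b n) * M (n-1) k`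
for `n ≥ t`, `k ≥ 1`, where summands with a negative first index vanish. -/
def latticeM {R : Type*} [CommRing R] (t ℓ : ℕ) (a : ℕ → ℕ → R) (b : ℕ → R) :
    ℕ → ℕ → R
  | n, 0 => ∏ i ∈ Finset.Icc 1 n, b i
  | 0, k + 1 => if t = 0 then a 0 0 * latticeM t ℓ a b 0 k else 0
  | n + 1, k + 1 =>
      if n + 1 < t then 0
      else (∑ i ∈ Finset.range (ℓ + 1),
              if t + i ≤ n + 1 then a (n + 1) i * latticeM t ℓ a b (n + 1 - t - i) k
              else 0)
        + b (n + 1) * latticeM t ℓ a b n (k + 1)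
  termination_by n k => (k, n)

/-- The Toeplitz matrix of a sequence: `𝒯(c) i j = c (i - j)` for `i ≥ j`
and `0` otherwise. -/
def toeplitz {R : Type*} [CommRing R] (c : ℕ → R) : ℕ → ℕ → R :=
  fun i j => if j ≤ i then c (i - j) else 0

namespace PolyNonneg

variable {σ : Type*} {p q : MvPolynomial σ ℝ}

theorem zero : PolyNonneg (0 : MvPolynomial σ ℝ) := fun m => by simp

theorem one : PolyNonneg (1 : MvPolynomial σ ℝ) := fun m => by
  classical
  rw [MvPolynomial.coeff_one]
  split_ifs <;> norm_num

theorem add (hp : PolyNonneg p) (hq : PolyNonneg q) : PolyNonneg (p + q) := fun m => by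
  rw [MvPolynomial.coeff_add]
  exact add_nonneg (hp m) (hq m)

theorem mul (hp : PolyNonneg p) (hq : PolyNonneg q) : PolyNonneg (p * q) := fun m => by
  classical
  rw [MvPolynomial.coeff_mul]
  exact Finset.sum_nonneg fun x _ => mul_nonneg (hp _) (hq _)

theorem sum {ι : Type*} {s : Finset ι} {f : ι → MvPolynomial σ ℝ}
    (h : ∀ i ∈ s, PolyNonneg (f i)) : PolyNonneg (∑ i ∈ s, f i) :=
  Finset.sum_induction f PolyNonneg (fun _ _ => add) zero h

theorem prod {ι : Type*} {s : Finset ι} {f : ι → MvPolynomial σ ℝ}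
    (h : ∀ i ∈ s, PolyNonneg (f i)) : PolyNonneg (∏ i ∈ s, f i) :=
  Finset.prod_induction f PolyNonneg (fun _ _ => mul) one h

end PolyNonneg

namespace TP

variable {σ : Type*} {X : ℕ → ℕ → MvPolynomial σ ℝ}

theorem zero : TP (fun _ _ => (0 : MvPolynomial σ ℝ)) := fun r hr ρ κ _ _ => by
  rw [Matrix.det_eq_zero_of_row_eq_zero ⟨0, hr⟩ (fun _ => rfl)]
  exact PolyNonneg.zero

theorem det_nonneg (hX : TP X) {r : ℕ} {ρ κ : Fin r → ℕ} (hρ : StrictMono ρ)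
    (hκ : StrictMono κ) : PolyNonneg (Matrix.of fun i j : Fin r => X (ρ i) (κ j)).det := by
  rcases Nat.eq_zero_or_pos r with rfl | hr
  · rw [Matrix.det_isEmpty]
    exact PolyNonneg.one
  · exact hX r hr ρ κ hρ hκ

theorem det_nonneg_of_monotone (hX : TP X) {r : ℕ} {ρ κ : Fin r → ℕ} (hρ : Monotone ρ)
    (hκ : StrictMono κ) : PolyNonneg (Matrix.of fun i j : Fin r => X (ρ i) (κ j)).det := by
  by_cases hinj : Function.Injective ρ
  · exact hX.det_nonneg (hρ.strictMono_of_injective hinj) hκ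
  · obtain ⟨i, j, hij, hne⟩ : ∃ i j, ρ i = ρ j ∧ i ≠ j := by
      simpa [Function.Injective] using hinj
    rw [Matrix.det_zero_of_row_eq hne (by ext c; simp [hij])]
    exact PolyNonneg.zero

/-- Replacing each row by a nonnegative combination of two rows preserves total positivity,
provided the rows used for smaller indices never exceed those used for larger ones. -/
theorem row_combination (hX : TP X) {u v : ℕ → MvPolynomial σ ℝ} {f g : ℕ → ℕ}
    (hu : ∀ p, PolyNonneg (u p)) (hv : ∀ p, PolyNonneg (v p))
    (hfg : ∀ p, f p ≤ g p) (hgf : ∀ p q, p < q → g p ≤ f q) :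
    TP fun p j => u p * X (f p) j + v p * X (g p) j := by
  intro r _ ρ κ hρ hκ
  let w : ℕ → Bool → MvPolynomial σ ℝ := fun p s => bif s then u p else v p
  let h : ℕ → Bool → ℕ := fun p s => bif s then f p else g p
  have hmat : (Matrix.of fun i j : Fin r =>
      u (ρ i) * X (f (ρ i)) (κ j) + v (ρ i) * X (g (ρ i)) (κ j)) =
      fun i => ∑ s : Bool, w (ρ i) s • fun j => X (h (ρ i) s) (κ j) := by
    funext i j
    simp [w, h]
  have hdet : (Matrix.of fun i j : Fin r =>
      u (ρ i) * X (f (ρ i)) (κ j) + v (ρ i) * X (g (ρ i)) (κ j)).det =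
      ∑ s : Fin r → Bool, (∏ i, w (ρ i) (s i)) *
        (Matrix.of fun i j : Fin r => X (h (ρ i) (s i)) (κ j)).det := by
    rw [hmat]
    refine ((Matrix.detRowAlternating (n := Fin r)
      (R := MvPolynomial σ ℝ)).toMultilinearMap.map_sum _).trans ?_
    refine Finset.sum_congr rfl fun s _ => ?_
    exact MultilinearMap.map_smul_univ _ _ _
  rw [hdet]
  refine PolyNonneg.sum fun s _ => (PolyNonneg.prod fun i _ => ?_).mul ?_
  · cases s i
    · exact hv _
    · exact hu _
  · refine hX.det_nonneg_of_monotone (ρ := fun i => h (ρ i) (s i)) ?_ hκ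
    intro i j hij
    rcases hij.eq_or_lt with rfl | hij
    · exact le_rfl
    · have := hgf _ _ (hρ hij)
      have hi := hfg (ρ i)
      have hj := hfg (ρ j)
      dsimp only [h]
      cases s i <;> cases s j <;> simp only [cond_true, cond_false] <;> omega

/-- Adding a `1` at the lower right corner of the support of a totally positive matrix
preserves total positivity. -/
theorem add_corner (hX : TP X) {p₀ c₀ : ℕ} (hrow : ∀ p j, p₀ < p → X p j = 0)
    (hcol : ∀ p j, c₀ ≤ j → X p j = 0) :
    TP fun p j => X p j + if p = p₀ ∧ j = c₀ then 1 else 0 := by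
  intro r hr ρ κ hρ hκ
  obtain ⟨r, rfl⟩ : ∃ s, r = s + 1 := ⟨r - 1, by omega⟩
  have hκl : ∀ i : Fin r, κ i.castSucc < κ (Fin.last r) := fun i => hκ (Fin.castSucc_lt_last i)
  have hρl : ∀ i : Fin r, ρ i.castSucc < ρ (Fin.last r) := fun i => hρ (Fin.castSucc_lt_last i)
  rcases lt_trichotomy (κ (Fin.last r)) c₀ with hc | hc | hc
  · have hne : ∀ j, κ j ≠ c₀ := fun j =>
      ((hκ.monotone (Fin.le_last j)).trans_lt hc).ne
    simpa [hne] using hX.det_nonneg hρ hκ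
  · rcases lt_trichotomy (ρ (Fin.last r)) p₀ with hp | hp | hp
    · rw [Matrix.det_eq_zero_of_column_eq_zero (Fin.last r)]
      · exact PolyNonneg.zero
      · intro i
        have : ρ i ≠ p₀ := ((hρ.monotone (Fin.le_last i)).trans_lt hp).ne
        simp [this, hcol _ _ hc.ge]
    · rw [Matrix.det_succ_column _ (Fin.last r), Finset.sum_eq_single (Fin.last r)]
      · have hne : ∀ j : Fin r, κ j.castSucc ≠ c₀ := fun j => ((hκl j).trans_eq hc).ne
        have := hX.det_nonneg (hρ.comp (Fin.strictMono_castSucc (n := r)))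
          (hκ.comp (Fin.strictMono_castSucc (n := r)))
        have hsign : (-1 : MvPolynomial σ ℝ) ^ (r + r) = 1 := Even.neg_one_pow ⟨r, rfl⟩
        convert this using 1
        simp only [Matrix.of_apply, hp, hc, hcol _ _ le_rfl, Fin.val_last, hsign]
        simp only [and_self, if_true, zero_add, one_mul]
        congr 1
        ext i j : 2
        simp [hne]
      · intro i _ hi
        have : ρ i ≠ p₀ := by
          rw [← hp]
          exact fun h => hi (hρ.injective h)
        simp [this, hcol _ _ hc.ge]
      · simp
    · rw [Matrix.det_eq_zero_of_row_eq_zero (Fin.last r)]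
      · exact PolyNonneg.zero
      · intro j
        simp [hrow _ _ hp, hp.ne']
  · rw [Matrix.det_eq_zero_of_column_eq_zero (Fin.last r)]
    · exact PolyNonneg.zero
    · intro i
      simp [hcol _ _ hc.le, hc.ne']

end TP

/-- The matrix whose first `k` rows are `out 0, …, out (k - 1)`, followed by
`st n, …, st 0` and by zero rows. -/
def stackedRows {R : Type*} [CommRing R] (n : ℕ) (out : ℕ → ℕ → R) (k : ℕ)
    (st : ℕ → ℕ → R) : ℕ → ℕ → R :=
  fun p j => if p < k then out p j else if p ≤ k + n then st (k + n - p) j else 0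

section stackedRows

variable {σ : Type*} {n k : ℕ} {out st : ℕ → ℕ → MvPolynomial σ ℝ}

theorem stackedRows_of_lt {p : ℕ} (h : p < k) (j : ℕ) :
    stackedRows n out k st p j = out p j := if_pos h

theorem stackedRows_of_add_eq {p m : ℕ} (hm : m ≤ n) (h : p + m = k + n) (j : ℕ) :
    stackedRows n out k st p j = st m j := by
  unfold stackedRows
  rw [if_neg (by omega), if_pos (by omega), show k + n - p = m by omega]

theorem stackedRows_of_gt {p : ℕ} (h : k + n < p) (j : ℕ) :
    stackedRows n out k st p j = 0 := by
  unfold stackedRows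
  rw [if_neg (by omega), if_neg (by omega)]

theorem stackedRows_congr {st' : ℕ → ℕ → MvPolynomial σ ℝ}
    (h : ∀ m ≤ n, ∀ j, st m j = st' m j) :
    stackedRows n out k st = stackedRows n out k st' := by
  funext p j
  unfold stackedRows
  split_ifs
  · rfl
  · exact h _ (by omega) j
  · rfl

theorem TP.stackedRows_add_pred (hX : TP (stackedRows n out k st))
    (hout : ∀ j, out k j = st n j) :
    TP (stackedRows n out (k + 1)
      fun m j => st m j + if m = 0 then 0 else st (m - 1) j) := by
  convert hX.row_combination (u := fun _ => 1) (v := fun p => if p ≤ k then 0 else 1)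
    (f := fun p => if p ≤ k then p else p - 1) (g := fun p => p) (fun _ => PolyNonneg.one)
    (fun p => by split_ifs; exacts [PolyNonneg.zero, PolyNonneg.one])
    (fun p => by split_ifs <;> omega) (fun p q h => by split_ifs <;> omega)
    using 1
  funext p j
  rcases lt_trichotomy p k with h | rfl | h
  · rw [stackedRows_of_lt (by omega)]
    simp [h.le, stackedRows_of_lt h]
  · rw [stackedRows_of_lt (by omega)]
    simp [hout, stackedRows_of_add_eq le_rfl rfl]
  · simp only [h.not_ge, if_false, one_mul]
    rcases lt_or_ge (k + 1 + n) p with hp | hp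
    · rw [stackedRows_of_gt hp, stackedRows_of_gt (by omega), stackedRows_of_gt (by omega),
        add_zero]
    · obtain ⟨m, hm⟩ := Nat.exists_eq_add_of_le' hp
      rw [stackedRows_of_add_eq (m := m) (by omega) (by omega),
        stackedRows_of_add_eq (m := m) (p := p - 1) (by omega) (by omega)]
      rcases m with _ | m
      · rw [stackedRows_of_gt (by omega), if_pos rfl]
      · rw [stackedRows_of_add_eq (m := m) (by omega) (by omega), if_neg (by omega),
          Nat.add_sub_cancel]

theorem TP.stackedRows_band (hX : TP (stackedRows n out (k + 1) st)) (t : ℕ)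
    {u v : ℕ → MvPolynomial σ ℝ} (hu : ∀ m, PolyNonneg (u m)) (hv : ∀ m, PolyNonneg (v m)) :
    TP (stackedRows n out (k + 1) fun m j =>
      (if t ≤ m then u m * st (m - t) j else 0) +
        if t + 1 ≤ m then v m * st (m - t - 1) j else 0) := by
  convert hX.row_combination
    (u := fun p => if p ≤ k then 1 else u (k + 1 + n - p))
    (v := fun p => if p ≤ k then 0 else v (k + 1 + n - p))
    (f := fun p => if p ≤ k then p else p + t)
    (g := fun p => if p ≤ k then p else p + t + 1)
    (fun p => by split_ifs; exacts [PolyNonneg.one, hu _])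
    (fun p => by split_ifs; exacts [PolyNonneg.zero, hv _])
    (fun p => by split_ifs <;> omega) (fun p q h => by split_ifs <;> omega)
    using 1
  funext p j
  by_cases h : p ≤ k
  · simp [h, stackedRows_of_lt (Nat.lt_succ_of_le h)]
  · simp only [h, if_false]
    rcases lt_or_ge (k + 1 + n) p with hp | hp
    · rw [stackedRows_of_gt hp, stackedRows_of_gt (by omega), stackedRows_of_gt (by omega)]
      simp
    · obtain ⟨m, hm⟩ := Nat.exists_eq_add_of_le' hp
      rw [stackedRows_of_add_eq (m := m) (by omega) (by omega),
        show k + 1 + n - p = m by omega]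
      congr 1
      · split_ifs with ht
        · rw [stackedRows_of_add_eq (m := m - t) (by omega) (by omega)]
        · rw [stackedRows_of_gt (by omega), mul_zero]
      · split_ifs with ht
        · rw [stackedRows_of_add_eq (m := m - t - 1) (by omega) (by omega)]
        · rw [stackedRows_of_gt (by omega), mul_zero]

theorem TP.stackedRows_add_source (hX : TP (stackedRows n out k st))
    (hout : ∀ p < k, ∀ j, k ≤ j → out p j = 0) (hst : ∀ m j, k ≤ j → st m j = 0) :
    TP (stackedRows n out k fun m j => st m j + if m = 0 ∧ j = k then 1 else 0) := by
  convert hX.add_corner (p₀ := k + n) (c₀ := k) (fun p j hp => ?_) (fun p j hj => ?_) using 1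
  · funext p j
    rcases lt_or_ge p k with h | h
    · simp [stackedRows_of_lt h, show p ≠ k + n by omega]
    rcases lt_or_ge (k + n) p with hp | hp
    · simp [stackedRows_of_gt hp, hp.ne']
    · obtain ⟨m, hm⟩ := Nat.exists_eq_add_of_le' hp
      have hiff : p = k + n ↔ m = 0 := by omega
      simp only [stackedRows_of_add_eq (show m ≤ n by omega) (show p + m = k + n by omega), hiff]
  · exact stackedRows_of_gt hp j
  · unfold stackedRows
    split_ifs with h
    exacts [hout _ h _ hj, hst _ _ hj, rfl]

theorem TP.stackedRows_cumulative {z : ℕ → ℕ → MvPolynomial σ ℝ}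
    {b : ℕ → MvPolynomial σ ℝ} (hX : TP (stackedRows n out k z))
    (hb : ∀ m, PolyNonneg (b m)) (hzero : ∀ j, st 0 j = z 0 j)
    (hsucc : ∀ m j, st (m + 1) j = z (m + 1) j + b (m + 1) * st m j) :
    TP (stackedRows n out k st) := by
  have key : ∀ s ≤ n, TP (stackedRows n out k fun m j => if m ≤ s then st m j else z m j) := by
    intro s
    induction s with
    | zero =>
      intro _
      convert hX using 2
      funext m j
      split_ifs with h
      · obtain rfl : m = 0 := by omega
        exact hzero j
      · rfl
    | succ s ih =>
      intro hs
      convert (ih (by omega)).row_combination (u := fun _ => 1)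
        (v := fun p => if p + (s + 1) = k + n then b (s + 1) else 0)
        (f := fun p => p) (g := fun p => if p + (s + 1) = k + n then p + 1 else p)
        (fun _ => PolyNonneg.one) (fun p => by split_ifs; exacts [hb _, PolyNonneg.zero])
        (fun p => by split_ifs <;> omega) (fun p q h => by split_ifs <;> omega)
        using 1
      funext p j
      by_cases hp : p + (s + 1) = k + n
      · simp only [hp, if_true, one_mul]
        rw [stackedRows_of_add_eq (m := s + 1) hs hp,
          stackedRows_of_add_eq (m := s + 1) hs hp,
          stackedRows_of_add_eq (m := s) (by omega) (by omega), if_pos le_rfl,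
          if_neg (by omega), if_pos le_rfl]
        exact hsucc s j
      · simp only [hp, if_false, one_mul, zero_mul, add_zero]
        unfold stackedRows
        dsimp only
        split_ifs <;> first | rfl | omega
  rw [stackedRows_congr (st' := fun m j => if m ≤ n then st m j else z m j)
    fun m hm j => (if_pos hm).symm]
  exact key n le_rfl

end stackedRows

section latticeM

variable {R : Type*} [CommRing R] {t ℓ : ℕ} {a : ℕ → ℕ → R} {b : ℕ → R}

theorem latticeM_zero_right (n : ℕ) : latticeM t ℓ a b n 0 = ∏ i ∈ Finset.Icc 1 n, b i := by
  rw [latticeM]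

theorem latticeM_succ_of_lt {n : ℕ} (h : n < t) (k : ℕ) : latticeM t ℓ a b n (k + 1) = 0 := by
  cases n with
  | zero => rw [latticeM, if_neg (by omega)]
  | succ n => rw [latticeM, if_pos h]

theorem latticeM_zero_succ (k : ℕ) : latticeM t ℓ a b 0 (k + 1) =
    ∑ i ∈ Finset.range (ℓ + 1),
      if t + i ≤ 0 then a 0 i * latticeM t ℓ a b (0 - t - i) k else 0 := by
  rw [latticeM, Finset.sum_range_succ', Finset.sum_eq_zero fun i _ => if_neg (by omega)]
  simp

theorem latticeM_succ_succ (n k : ℕ) : latticeM t ℓ a b (n + 1) (k + 1) =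
    (∑ i ∈ Finset.range (ℓ + 1),
      if t + i ≤ n + 1 then a (n + 1) i * latticeM t ℓ a b (n + 1 - t - i) k else 0) +
      b (n + 1) * latticeM t ℓ a b n (k + 1) := by
  by_cases h : n + 1 < t
  · rw [latticeM_succ_of_lt h, latticeM_succ_of_lt (show n < t by omega),
      Finset.sum_eq_zero fun i _ => if_neg (by omega)]
    simp
  · rw [latticeM, if_neg h]

theorem toeplitz_latticeM_zero_succ (k j : ℕ) :
    toeplitz (latticeM t ℓ a b 0) (k + 1) j =
      (∑ i ∈ Finset.range (ℓ + 1),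
        if t + i ≤ 0 then a 0 i * toeplitz (latticeM t ℓ a b (0 - t - i)) k j else 0) +
        if j = k + 1 then 1 else 0 := by
  unfold toeplitz
  rcases lt_trichotomy j (k + 1) with h | rfl | h
  · rw [if_pos h.le, if_neg h.ne, show k + 1 - j = k - j + 1 by omega, latticeM_zero_succ]
    simp only [show j ≤ k by omega, if_true, add_zero]
  · simp [latticeM_zero_right]
  · simp [show ¬ j ≤ k by omega, show ¬ j ≤ k + 1 by omega, h.ne']

theorem toeplitz_latticeM_succ_succ (m k j : ℕ) :
    toeplitz (latticeM t ℓ a b (m + 1)) (k + 1) j =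
      (∑ i ∈ Finset.range (ℓ + 1), if t + i ≤ m + 1 then
        a (m + 1) i * toeplitz (latticeM t ℓ a b (m + 1 - t - i)) k j else 0) +
        b (m + 1) * toeplitz (latticeM t ℓ a b m) (k + 1) j := by
  unfold toeplitz
  rcases lt_trichotomy j (k + 1) with h | rfl | h
  · rw [if_pos h.le, if_pos h.le, show k + 1 - j = k - j + 1 by omega, latticeM_succ_succ]
    simp only [show j ≤ k by omega, if_true]
  · simp [latticeM_zero_right, Finset.prod_Icc_succ_top, mul_comm]
  · simp [show ¬ j ≤ k by omega, show ¬ j ≤ k + 1 by omega]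

/-- The banded row operation of width three factors through two operations of width two. -/
theorem sum_band_eq (h1 : a 1 1 = a 1 0) (h2 : ∀ n, 2 ≤ n → a n 1 = a n 0 + a n 2)
    (x : ℕ → R) (m : ℕ) :
    (∑ i ∈ Finset.range (2 + 1), if t + i ≤ m then a m i * x (m - t - i) else 0) =
      (if t ≤ m then a m 0 * (x (m - t) + if m - t = 0 then 0 else x (m - t - 1)) else 0) +
      if t + 1 ≤ m then (if m = 1 then 0 else a m 2) *
        (x (m - t - 1) + if m - t - 1 = 0 then 0 else x (m - t - 1 - 1)) else 0 := by
  simp only [Finset.sum_range_succ, Finset.sum_range_zero, zero_add, add_zero, Nat.sub_zero]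
  by_cases h0 : t ≤ m
  · obtain ⟨d, rfl⟩ := Nat.exists_eq_add_of_le h0
    rw [Nat.add_sub_cancel_left]
    rcases d with _ | _ | d
    · simp
    · rcases t with _ | t
      · simp [h1]
        ring
      · simp [h2 (t + 1 + 1) (by omega)]
        ring
    · simp [h2 (t + (d + 1 + 1)) (by omega), show t + (d + 1 + 1) ≠ 1 by omega,
        show t + 1 ≤ t + (d + 1 + 1) by omega]
      ring
  · rw [if_neg h0, if_neg (by omega), if_neg (by omega), if_neg h0, if_neg (by omega)]
    simp

end latticeM

theorem tp_stackedRows_latticeM {σ : Type*} {t : ℕ} {a : ℕ → ℕ → MvPolynomial σ ℝ}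
    {b : ℕ → MvPolynomial σ ℝ}
    (ha : ∀ n i, i ≤ 2 → PolyNonneg (a n i)) (hb : ∀ n, PolyNonneg (b n))
    (h1 : a 1 1 = a 1 0) (h2 : ∀ n, 2 ≤ n → a n 1 = a n 0 + a n 2) (n k : ℕ) :
    TP (stackedRows n (toeplitz (latticeM t 2 a b n)) k
      fun m => toeplitz (latticeM t 2 a b m) k) := by
  induction k with
  | zero =>
    have hzero : TP (stackedRows n (toeplitz (latticeM t 2 a b n)) 0 fun _ _ => 0) := by
      convert TP.zero (σ := σ) using 1
      funext p j
      simp [stackedRows]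
    refine (hzero.stackedRows_add_source (fun p hp => absurd hp (Nat.not_lt_zero p))
      fun _ _ _ => rfl).stackedRows_cumulative hb (fun j => ?_) fun m j => ?_
    · rcases j with _ | j <;> simp [toeplitz, latticeM_zero_right]
    · rcases j with _ | j <;>
        simp [toeplitz, latticeM_zero_right, Finset.prod_Icc_succ_top, mul_comm]
  | succ k ih =>
    have hcol : ∀ (c : ℕ → MvPolynomial σ ℝ) (i j : ℕ), i < j → toeplitz c i j = 0 :=
      fun c i j hij => if_neg (by omega)
    have hA := (ih.stackedRows_add_pred fun _ => rfl).stackedRows_band t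
      (u := fun m => a m 0) (v := fun m => if m = 1 then 0 else a m 2)
      (fun m => ha m 0 (by omega))
      (fun m => by split_ifs; exacts [PolyNonneg.zero, ha m 2 le_rfl])
    refine (hA.stackedRows_add_source (fun p hp j hj => hcol _ _ _ (by omega))
      fun m j hj => ?_).stackedRows_cumulative hb (fun j => ?_) fun m j => ?_
    · simp [hcol _ k j (by omega)]
    · rw [toeplitz_latticeM_zero_succ,
        sum_band_eq h1 h2 (fun m => toeplitz (latticeM t 2 a b m) k j)]
      simp
    · rw [toeplitz_latticeM_succ_succ,
        sum_band_eq h1 h2 (fun m => toeplitz (latticeM t 2 a b m) k j)]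
      simp

/-- **Corollary (first sufficient condition for `ℓ = 2`).**  Suppose `ℓ = 2`,
`a 1 1 = a 1 0`, and `a n 1 = a n 0 + a n 2` for all `n ≥ 2`.  Then the
weighted lattice-path matrix `M` is totally positive, and if moreover `t ≥ 1`
then every row of `M` has a totally positive Toeplitz matrix. -/
theorem latticeM_totallyPositive_of_cond_one
    {σ : Type*} (t : ℕ) (a : ℕ → ℕ → MvPolynomial σ ℝ) (b : ℕ → MvPolynomial σ ℝ)
    (ha : ∀ n i, i ≤ 2 → PolyNonneg (a n i)) (hb : ∀ n, PolyNonneg (b n))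
    (h1 : a 1 1 = a 1 0)
    (h2 : ∀ n, 2 ≤ n → a n 1 = a n 0 + a n 2) :
    TP (latticeM t 2 a b) ∧
      (1 ≤ t → ∀ n, TP (toeplitz fun k => latticeM t 2 a b n k)) := by
  have key := tp_stackedRows_latticeM (t := t) ha hb h1 h2
  refine ⟨fun r hr ρ κ hρ hκ => ?_, fun _ n r hr ρ κ hρ hκ => ?_⟩
  · obtain ⟨n, hn⟩ : ∃ n, ∀ i, ρ i ≤ n :=
      ⟨∑ i, ρ i, fun i => Finset.single_le_sum (fun _ _ => Nat.zero_le _) (Finset.mem_univ i)⟩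
    obtain ⟨k, hk⟩ : ∃ k, ∀ j, κ j ≤ k :=
      ⟨∑ j, κ j, fun j => Finset.single_le_sum (fun _ _ => Nat.zero_le _) (Finset.mem_univ j)⟩
    have := key n k r hr (fun i => k + n - ρ i.rev) (fun j => k - κ j.rev)
      (fun i j hij => by
        have := hρ (Fin.rev_lt_rev.2 hij)
        have := hn i.rev
        dsimp only
        omega)
      (fun i j hij => by
        have := hκ (Fin.rev_lt_rev.2 hij)
        have := hk i.rev
        dsimp only
        omega)
    rw [← Matrix.det_submatrix_equiv_self Fin.revPerm] at this
    convert this using 2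
    ext i j : 2
    have hi := hn i
    have hj := hk j
    simp only [Matrix.of_apply, Matrix.submatrix_apply, Fin.revPerm_apply, Fin.rev_rev,
      stackedRows, toeplitz]
    rw [if_neg (by omega), if_pos (by omega), if_pos (by omega),
      show k + n - (k + n - ρ i) = ρ i by omega, show k - (k - κ j) = κ j by omega]
  · obtain ⟨k, hk⟩ : ∃ k, ∀ i, ρ i < k := ⟨∑ i, ρ i + 1, fun i => Nat.lt_succ_of_le
      (Finset.single_le_sum (fun _ _ => Nat.zero_le _) (Finset.mem_univ i))⟩
    have := key n k r hr ρ κ hρ hκ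
    simpa only [stackedRows, hk, if_true] using this
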